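/- For every fixed h with k ≤ h ≤ n-l, the quantities w_{hi} satisfy w_{h,k+l} = 1, (provided k+l+1 ≤ n) w_{h,k+l+1} = 1 + (h-k)(2k+2l+σ+1)/((k+l-n)(β+2k+1)), and for k+l+2 ≤ i ≤ n the three-term recurrence w_{hi} = P_h(i) w_{h,i-1} + S(i) w_{h,i-2}, where S(i) := (i-k-l-1)(i+β+α+n)(i+l+α-k-1)(2i+β+α) / [(2i+β+α-2)(i+k+l+β+α)(i+k+β-l)(i-n-1)] and P_h(i) := 1 - S(i) - (k-h)(2i+α+β-1)_2 / ((i+k+l+α+β)(i+k+β-l)(i-n-1)), with σ := α+β+1. (Second part of Theorem 4.3.) -/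

import Mathlib

open Finset

/-- Pochhammer symbol `(x)_m = x (x+1) ⋯ (x+m-1)`. -/
noncomputable def poch (x : ℝ) (m : ℕ) : ℝ := ∏ j ∈ Finset.range m, (x + j)

/-- Bernstein polynomial `B_j^n(x) = C(n,j) x^j (1-x)^(n-j)`. -/
noncomputable def bern (n j : ℕ) (x : ℝ) : ℝ := (n.choose j : ℝ) * x ^ j * (1 - x) ^ (n - j)

/-- Shifted Jacobi polynomial `R_i^(a,b)(x)`. -/
noncomputable def shiftedJacobi (a b : ℝ) (i : ℕ) (x : ℝ) : ℝ :=
  poch (a + 1) i / (Nat.factorial i : ℝ) *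
    ∑ j ∈ Finset.range (i + 1),
      poch (-(i : ℝ)) j * poch ((i : ℝ) + a + b + 1) j /
        ((Nat.factorial j : ℝ) * poch (a + 1) j) * (1 - x) ^ j

/-- Hahn polynomial `Q_m(t; a, b, N)`. -/
noncomputable def hahnQ (m : ℕ) (t : ℝ) (a b : ℝ) (N : ℕ) : ℝ :=
  ∑ j ∈ Finset.range (m + 1),
    poch (-(m : ℝ)) j * poch ((m : ℝ) + a + b + 1) j * poch (-t) j /
      ((Nat.factorial j : ℝ) * poch (a + 1) j * poch (-(N : ℝ)) j)

/-- Dual Hahn polynomial `R_m(λ(t); a, b, N)` with `λ(t) = t(t+a+b+1)`. -/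
noncomputable def dualHahnR (m : ℕ) (t : ℝ) (a b : ℝ) (N : ℕ) : ℝ :=
  ∑ j ∈ Finset.range (m + 1),
    poch (-(m : ℝ)) j * poch (t + a + b + 1) j * poch (-t) j /
      ((Nat.factorial j : ℝ) * poch (a + 1) j * poch (-(N : ℝ)) j)

/-- Modified Jacobi polynomial `J_{i,k,l}^(α,β)(x) = (1-x)^l x^k R_{i-k-l}^(α+2l,β+2k)(x)`. -/
noncomputable def modJacobi (α β : ℝ) (k l i : ℕ) (x : ℝ) : ℝ :=
  (1 - x) ^ l * x ^ k * shiftedJacobi (α + 2 * l) (β + 2 * k) (i - k - l) x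

/-- Connection coefficient `c_{ih}` of the Bernstein form of the modified Jacobi polynomials. -/
noncomputable def cCoef (α β : ℝ) (n k l i h : ℕ) : ℝ :=
  poch (α + 2 * l + 1) (i - k - l) / (Nat.factorial (i - k - l) : ℝ) *
    (n.choose h : ℝ)⁻¹ * ((n - k - l).choose (h - k) : ℝ) *
    hahnQ (i - k - l) ((n : ℝ) - l - h) (α + 2 * l) (β + 2 * k) (n - k - l)

/-- The quantity `z_{hi}`. -/
noncomputable def zCoef (α β : ℝ) (n k l h i : ℕ) : ℝ :=
  (n.choose h : ℝ) * (2 * (i : ℝ) + (α + β + 1)) * poch ((k : ℝ) + l - n) (i - k - l) *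
      poch (α + 2 * l + 1) (n - l - h) * poch (β + 2 * k + 1) (h - k) /
    (poch (α + 2 * l + 1) (i - k - l) * poch ((i : ℝ) + k + l + (α + β + 1)) (n + 1 - k - l))

/-- The quantity `w_{hi}`. -/
noncomputable def wCoef (α β : ℝ) (n k l h i : ℕ) : ℝ :=
  hahnQ (i - k - l) ((h : ℝ) - k) (β + 2 * k) (α + 2 * l) (n - k - l)

/-- Connection coefficient `d_{hi}` of the modified Jacobi form of Bernstein polynomials. -/
noncomputable def dCoef (α β : ℝ) (n k l h i : ℕ) : ℝ := zCoef α β n k l h i * wCoef α β n k l h i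

/-- Coefficient `a_{ih}^(m,a,b) = (-1)^i ((b+1)_i / i!) Q_i(h; b, a, m)`. -/
noncomputable def aCoef (m : ℕ) (a b : ℝ) (i h : ℕ) : ℝ :=
  (-1 : ℝ) ^ i * poch (b + 1) i / (Nat.factorial i : ℝ) * hahnQ i (h : ℝ) b a m

/-- Coefficient `b_{hi}^(m,a,b)`. -/
noncomputable def bCoef (m : ℕ) (a b : ℝ) (h i : ℕ) : ℝ :=
  (m.choose h : ℝ) * (2 * (i : ℝ) + a + b + 1) * poch (-(m : ℝ)) i * poch (a + 1) (m - h) *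
      poch (b + 1) h / (poch (a + 1) i * poch ((i : ℝ) + a + b + 1) (m + 1)) *
    hahnQ i (h : ℝ) b a m

/-- The quantity `S(i)` of Theorem 4.3. -/
noncomputable def Sfun (α β : ℝ) (n k l i : ℕ) : ℝ :=
  ((i : ℝ) - k - l - 1) * ((i : ℝ) + β + α + n) * ((i : ℝ) + l + α - k - 1) *
      (2 * (i : ℝ) + β + α) /
    ((2 * (i : ℝ) + β + α - 2) * ((i : ℝ) + k + l + β + α) * ((i : ℝ) + k + β - l) *
      ((i : ℝ) - n - 1))

/-- The quantity `P_h(i)` of Theorem 4.3. -/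
noncomputable def Pfun (α β : ℝ) (n k l h i : ℕ) : ℝ :=
  1 - Sfun α β n k l i -
    ((k : ℝ) - h) * poch (2 * (i : ℝ) + α + β - 1) 2 /
      (((i : ℝ) + k + l + α + β) * ((i : ℝ) + k + β - l) * ((i : ℝ) - n - 1))

lemma poch_zero (x : ℝ) : poch x 0 = 1 := by simp [poch]

lemma poch_succ (x : ℝ) (m : ℕ) : poch x (m + 1) = poch x m * (x + m) := by
  simp [poch, Finset.prod_range_succ]

lemma poch_succ_left (x : ℝ) (m : ℕ) : poch x (m + 1) = x * poch (x + 1) m := by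
  simp only [poch, Finset.prod_range_succ', Nat.cast_zero, add_zero]
  rw [mul_comm]
  congr 1
  refine Finset.prod_congr rfl fun j _ => ?_
  push_cast
  ring

lemma poch_neg_nat_eq_zero {m j : ℕ} (h : m < j) : poch (-(m : ℝ)) j = 0 :=
  Finset.prod_eq_zero (Finset.mem_range.2 h) (by simp)

lemma poch_pos {x : ℝ} (hx : 0 < x) (m : ℕ) : 0 < poch x m :=
  Finset.prod_pos fun j _ => by positivity

lemma poch_neg_nat_ne_zero {N j : ℕ} (h : j ≤ N) : poch (-(N : ℝ)) j ≠ 0 := by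
  refine Finset.prod_ne_zero_iff.2 fun r hr => ?_
  have hr' : (r : ℝ) < N := by exact_mod_cast (Finset.mem_range.1 hr).trans_le h
  linarith

/-- The Hahn sum may be extended past its last nonzero term. -/
lemma hahnQ_eq_sum_range (m M : ℕ) (hM : m < M) (t a b : ℝ) (N : ℕ) :
    hahnQ m t a b N = ∑ j ∈ Finset.range M,
      poch (-(m : ℝ)) j * poch ((m : ℝ) + (a + b + 1)) j *
        (poch (-t) j / ((Nat.factorial j : ℝ) * poch (a + 1) j * poch (-(N : ℝ)) j)) := by
  rw [hahnQ]
  refine (Finset.sum_subset (Finset.range_mono hM) fun j _ hj => ?_).trans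
    (Finset.sum_congr rfl fun j _ => ?_)
  · rw [poch_neg_nat_eq_zero (by simpa using hj)]
    simp
  · rw [← add_assoc, ← add_assoc, mul_div_assoc]

/-- Coefficientwise form of the three-term recurrence of the Hahn polynomials, in the basis
`(-t)_j / (j! (a+1)_j (-N)_j)`. -/
lemma hahn_coeff_recurrence (x a b N : ℝ) (r : ℕ) (h₀ : 2 * x + a + b ≠ 0)
    (h₁ : 2 * x + a + b + 1 ≠ 0) (h₂ : 2 * x + a + b + 2 ≠ 0) :
    (x + a + b + 1) * (x + a + 1) * (N - x) / ((2 * x + a + b + 1) * (2 * x + a + b + 2)) *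
        (poch (-(x + 1)) (r + 1) * poch (x + 1 + (a + b + 1)) (r + 1) -
          poch (-x) (r + 1) * poch (x + (a + b + 1)) (r + 1)) +
      x * (x + a + b + N + 1) * (x + b) / ((2 * x + a + b) * (2 * x + a + b + 1)) *
        (poch (-(x - 1)) (r + 1) * poch (x - 1 + (a + b + 1)) (r + 1) -
          poch (-x) (r + 1) * poch (x + (a + b + 1)) (r + 1)) =
      (r + 1) * (a + 1 + r) * (-N + r) * (poch (-x) r * poch (x + (a + b + 1)) r) -
        (r + 1) * (poch (-x) (r + 1) * poch (x + (a + b + 1)) (r + 1)) := by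
  have e₁ : poch (-(x + 1)) (r + 1) = -(x + 1) * poch (-x) r := by
    rw [poch_succ_left]; ring_nf
  have e₂ : (x + a + b + 1) * poch (x + 1 + (a + b + 1)) (r + 1) =
      poch (x + (a + b + 1)) r * (x + (a + b + 1) + r) * (x + (a + b + 1) + r + 1) := by
    have := poch_succ_left (x + (a + b + 1)) (r + 1)
    rw [poch_succ, poch_succ] at this
    push_cast at this
    rw [show x + (a + b + 1) + 1 = x + 1 + (a + b + 1) by ring] at this
    linear_combination -this
  have e₃ : x * poch (-(x - 1)) (r + 1) = -(poch (-x) r * (-x + r) * (-x + r + 1)) := by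
    have := poch_succ_left (-x) (r + 1)
    rw [poch_succ, poch_succ] at this
    push_cast at this
    rw [show -x + 1 = -(x - 1) by ring] at this
    linear_combination this
  have e₄ : poch (x - 1 + (a + b + 1)) (r + 1) = (x + a + b) * poch (x + (a + b + 1)) r := by
    rw [poch_succ_left]; ring_nf
  rw [e₁, e₄, poch_succ (-x), poch_succ (x + (a + b + 1))]
  generalize poch (-x) r = X at *
  generalize poch (x + (a + b + 1)) r = Y at *
  generalize poch (x + 1 + (a + b + 1)) (r + 1) = Z at *
  generalize poch (-(x - 1)) (r + 1) = W at *
  trans (x + a + 1) * (N - x) / ((2 * x + a + b + 1) * (2 * x + a + b + 2)) *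
        (-(x + 1) * X * (Y * (x + (a + b + 1) + r) * (x + (a + b + 1) + r + 1)) -
          (x + a + b + 1) * (X * (-x + r) * (Y * (x + (a + b + 1) + r)))) +
      (x + a + b + N + 1) * (x + b) / ((2 * x + a + b) * (2 * x + a + b + 1)) *
        (-(X * (-x + r) * (-x + r + 1)) * ((x + a + b) * Y) -
          x * (X * (-x + r) * (Y * (x + (a + b + 1) + r))))
  · rw [← e₂, ← e₃]
    ring
  · obtain ⟨p, rfl⟩ : ∃ p, b = p - (2 * x + a + 1) := ⟨2 * x + a + 1 + b, by ring⟩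
    rw [show 2 * x + a + (p - (2 * x + a + 1)) = p - 1 by ring] at h₀ h₁ h₂ ⊢
    rw [show p - 1 + 1 = p by ring, show p - 1 + 2 = p + 1 by ring] at *
    field_simp
    ring

/-- Three-term recurrence of the Hahn polynomials in the degree. -/
lemma hahnQ_recurrence (m N : ℕ) (hm : m + 2 ≤ N) (t a b : ℝ) (ha : -1 < a) (hb : -1 < b)
    (x : ℝ) (hx : x = m + 1) :
    (x + a + b + 1) * (x + a + 1) * (N - x) / ((2 * x + a + b + 1) * (2 * x + a + b + 2)) *
        (hahnQ (m + 2) t a b N - hahnQ (m + 1) t a b N) +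
      x * (x + a + b + N + 1) * (x + b) / ((2 * x + a + b) * (2 * x + a + b + 1)) *
        (hahnQ m t a b N - hahnQ (m + 1) t a b N) = -t * hahnQ (m + 1) t a b N := by
  have hm0 : (0 : ℝ) ≤ m := m.cast_nonneg
  have key := fun r : ℕ => hahn_coeff_recurrence x a b N r (by linarith) (by linarith)
    (by linarith)
  rw [hahnQ_eq_sum_range (m + 2) (m + 3) (by omega), hahnQ_eq_sum_range m (m + 3) (by omega),
    hahnQ_eq_sum_range (m + 1) (m + 3) (by omega)]
  rw [show ((m + 2 : ℕ) : ℝ) = x + 1 by rw [hx]; push_cast; ring,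
    show ((m + 1 : ℕ) : ℝ) = x by rw [hx]; push_cast; ring,
    show (m : ℝ) = x - 1 by rw [hx]; ring]
  set u : ℕ → ℝ := fun j =>
    poch (-t) j / ((Nat.factorial j : ℝ) * poch (a + 1) j * poch (-(N : ℝ)) j) with hu
  set c : ℕ → ℝ := fun j => poch (-x) j * poch (x + (a + b + 1)) j with hc
  have hlast : c (m + 2) = 0 := by
    simp only [hc]
    rw [show x = ((m + 1 : ℕ) : ℝ) by rw [hx]; push_cast; ring,
      poch_neg_nat_eq_zero (by omega), zero_mul]
  have hstep : ∀ r ∈ Finset.range (m + 2),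
      ((r : ℝ) + 1) * (a + 1 + r) * (-N + r) * u (r + 1) = (r - t) * u r := by
    intro r hr
    have hrN : r + 1 ≤ N := by have := Finset.mem_range.1 hr; omega
    have h₁ := (poch_pos (show 0 < a + 1 by linarith) (r + 1)).ne'
    have h₂ := poch_neg_nat_ne_zero hrN
    rw [poch_succ] at h₁ h₂
    obtain ⟨h₃, h₃'⟩ := mul_ne_zero_iff.1 h₁
    obtain ⟨h₄, h₄'⟩ := mul_ne_zero_iff.1 h₂
    have h₅ : (r.factorial : ℝ) ≠ 0 := by positivity
    have h₆ : (r : ℝ) + 1 ≠ 0 := by positivity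
    simp only [hu, poch_succ, Nat.factorial_succ]
    push_cast
    field_simp
    ring
  have hsum : ∑ j ∈ Finset.range (m + 3), (j : ℝ) * (c j * u j) =
      ∑ r ∈ Finset.range (m + 2), ((r : ℝ) + 1) * (c (r + 1) * u (r + 1)) := by
    rw [Finset.sum_range_succ']
    simp
  rw [← Finset.sum_sub_distrib, ← Finset.sum_sub_distrib, Finset.mul_sum, Finset.mul_sum,
    ← Finset.sum_add_distrib, Finset.sum_range_succ']
  simp only [poch_zero, sub_self, mul_zero, add_zero]
  have hterm : ∑ r ∈ Finset.range (m + 2),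
      (((r : ℝ) - t) * u r * c r - (r + 1) * (c (r + 1) * u (r + 1))) =
      -t * ∑ j ∈ Finset.range (m + 3), c j * u j := by
    rw [Finset.sum_sub_distrib, ← hsum, Finset.sum_range_succ (n := m + 2),
      Finset.sum_range_succ (n := m + 2), hlast, zero_mul, mul_zero, add_zero, add_zero,
      Finset.mul_sum, ← Finset.sum_sub_distrib]
    exact Finset.sum_congr rfl fun r _ => by ring
  rw [← hterm]
  refine Finset.sum_congr rfl fun r hr => ?_
  simp only [hc]
  linear_combination u (r + 1) * key r + poch (-x) r * poch (x + (a + b + 1)) r * hstep r hr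

/-- Second part of Theorem 4.3: recurrence for `w_{hi}` in `i`. -/
theorem wCoef_recurrence_in_i (α β : ℝ) (hα : -1 < α) (hβ : -1 < β)
    (n k l : ℕ) (hkl : k + l ≤ n) :
    ∀ h : ℕ, k ≤ h → h ≤ n - l →
      wCoef α β n k l h (k + l) = 1 ∧
      (k + l + 1 ≤ n →
        wCoef α β n k l h (k + l + 1) =
          1 + ((h : ℝ) - k) * (2 * (k : ℝ) + 2 * l + (α + β + 1) + 1) /
            (((k : ℝ) + l - n) * (β + 2 * k + 1))) ∧
      ∀ i : ℕ, k + l + 2 ≤ i → i ≤ n →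
        wCoef α β n k l h i =
          Pfun α β n k l h i * wCoef α β n k l h (i - 1) +
            Sfun α β n k l i * wCoef α β n k l h (i - 2) := by
  intro h _ _
  refine ⟨?_, fun h₁ => ?_, fun i hi hin => ?_⟩
  · simp [wCoef, hahnQ, poch]
  · obtain ⟨d, rfl⟩ := Nat.exists_eq_add_of_le h₁
    simp only [wCoef, hahnQ]
    rw [show k + l + 1 - k - l = 1 by omega, show k + l + 1 + d - k - l = d + 1 by omega]
    simp only [Finset.sum_range_succ, Finset.sum_range_zero, poch, Finset.prod_range_succ,
      Finset.prod_range_zero]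
    push_cast
    have hk : β + 2 * k + 1 ≠ 0 := by
      have : (0 : ℝ) ≤ k := k.cast_nonneg
      linarith
    have hd : (d : ℝ) + 1 ≠ 0 := by positivity
    rw [show (k : ℝ) + l - (k + l + 1 + d) = -((d : ℝ) + 1) by ring]
    simp
    field_simp
    ring
  · obtain ⟨m, rfl⟩ := Nat.exists_eq_add_of_le hi
    obtain ⟨d, rfl⟩ := Nat.exists_eq_add_of_le hin
    have hk : (0 : ℝ) ≤ k := k.cast_nonneg
    have hl : (0 : ℝ) ≤ l := l.cast_nonneg
    have hm : (0 : ℝ) ≤ m := m.cast_nonneg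
    have hd : (0 : ℝ) ≤ d := d.cast_nonneg
    have key := hahnQ_recurrence m (m + d + 2) (by omega) ((h : ℝ) - k) (β + 2 * k)
      (α + 2 * l) (by linarith) (by linarith) (m + 1) rfl
    simp only [wCoef, Pfun, Sfun]
    rw [show k + l + 2 + m - k - l = m + 2 by omega,
      show k + l + 2 + m - 1 - k - l = m + 1 by omega,
      show k + l + 2 + m - 2 - k - l = m by omega,
      show k + l + 2 + m + d - k - l = m + d + 2 by omega]
    generalize hahnQ (m + 2) _ _ _ _ = Q₂ at *
    generalize hahnQ (m + 1) _ _ _ _ = Q₁ at *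
    generalize hahnQ m _ _ _ _ = Q₀ at *
    simp only [poch, Finset.prod_range_succ, Finset.prod_range_zero]
    push_cast at key ⊢
    set T : ℝ := 2 * m + 2 * k + 2 * l + α + β with hT
    set U : ℝ := m + 2 * k + 2 * l + α + β + 2 with hU
    set V : ℝ := m + 2 * k + β + 2 with hV
    set D : ℝ := d + 1 with hD
    have hT₂ : T + 2 ≠ 0 := by linarith
    have hT₃ : T + 3 ≠ 0 := by linarith
    have hT₄ : T + 4 ≠ 0 := by linarith
    have hU₀ : U ≠ 0 := by linarith
    have hV₀ : V ≠ 0 := by linarith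
    have hD₀ : D ≠ 0 := by linarith
    have key' : U * V * D / ((T + 3) * (T + 4)) * (Q₂ - Q₁) +
        (m + 1) * (U + m + d + 2) * (m + 1 + α + 2 * l) / ((T + 2) * (T + 3)) * (Q₀ - Q₁) =
        -(h - k) * Q₁ := by
      rw [← key, show (2 * ((m : ℝ) + 1) + (β + 2 * k) + (α + 2 * l)) = T + 2 by ring,
        show ((m : ℝ) + 1 + (β + 2 * k) + (α + 2 * l) + 1) = U by ring,
        show ((m : ℝ) + 1 + (β + 2 * k) + 1) = V by ring,
        show (m : ℝ) + d + 2 - (m + 1) = D by ring]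
      congr 3 <;> ring
    have hS : ((k : ℝ) + l + 2 + m - k - l - 1) * (k + l + 2 + m + β + α + (k + l + 2 + m + d)) *
        (k + l + 2 + m + l + α - k - 1) * (2 * (k + l + 2 + m) + β + α) /
        ((2 * (k + l + 2 + m) + β + α - 2) * (k + l + 2 + m + k + l + β + α) *
          (k + l + 2 + m + k + β - l) * (k + l + 2 + m - (k + l + 2 + m + d) - 1)) =
        -((m + 1) * (U + m + d + 2) * (m + 1 + α + 2 * l) * (T + 4) / ((T + 2) * U * V * D)) := by
      rw [← div_neg]
      congr 1 <;> simp only [hT, hU, hV, hD] <;> ring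
    have hP : ((k : ℝ) - h) * (1 * (2 * (k + l + 2 + m) + α + β - 1 + 0) *
        (2 * (k + l + 2 + m) + α + β - 1 + 1)) /
        ((k + l + 2 + m + k + l + α + β) * (k + l + 2 + m + k + β - l) *
          (k + l + 2 + m - (k + l + 2 + m + d) - 1)) =
        (h - k) * ((T + 3) * (T + 4)) / (U * V * D) := by
      rw [← neg_div_neg_eq]
      congr 1 <;> simp only [hT, hU, hV, hD] <;> ring
    rw [hS, hP]
    clear_value T U V D
    field_simp at key' ⊢
    linear_combination key'
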